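/- arXiv:0803.2483 — 2 statements merged into one kernel-verified Lean document; each statement's English description precedes it below -/
import Mathlib

section
/- Let ε ∈ {−1,1} and r ≥ 1 be an integer. Then #{m ≤ x : μ(m) = ε and gcd(m,r) = 1} is asymptotically 3x/(π² ∏_{p|r}(1 + 1/p)) as x → ∞; i.e., the ratio of the two quantities tends to 1. -/
open Filter

/-- The Fejér kernel, whose Fourier transform is a triangle function. -/
noncomputable def fejer (v : ℝ) : ℝ := Real.sinc (v / 2) ^ 2 / 2

lemma fejer_nonneg (v : ℝ) : 0 ≤ fejer v := by unfold fejer; positivity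

lemma continuous_fejer : Continuous fejer := by
  unfold fejer
  fun_prop

lemma fejer_of_ne_zero {v : ℝ} (hv : v ≠ 0) : fejer v = (1 - Real.cos v) / v ^ 2 := by
  have h : Real.cos v = 1 - 2 * Real.sin (v / 2) ^ 2 := by
    rw [← Real.cos_sq_add_sin_sq (v / 2), show v = 2 * (v / 2) by ring, Real.cos_two_mul]
    ring_nf
    nlinarith [Real.cos_sq_add_sin_sq (v * (1 / 2))]
  rw [fejer, Real.sinc_of_ne_zero (by simpa using hv), h]
  field_simp
  ring

lemma fejer_le (v : ℝ) : fejer v ≤ 5 / 2 * (1 + v ^ 2)⁻¹ := by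
  have h1 : fejer v ≤ 1 / 2 := by
    have := abs_le.mpr ⟨Real.neg_one_le_sinc (v / 2), Real.sinc_le_one (v / 2)⟩
    have := (sq_le_one_iff_abs_le_one _).mpr this
    unfold fejer
    linarith
  have h2 : fejer v * v ^ 2 ≤ 2 := by
    rcases eq_or_ne v 0 with rfl | hv
    · simp
    · rw [fejer_of_ne_zero hv, div_mul_cancel₀ _ (by positivity)]
      linarith [Real.neg_one_le_cos v]
  rw [← div_eq_mul_inv, le_div_iff₀ (by positivity)]
  linarith

lemma integrable_fejer : MeasureTheory.Integrable fejer := by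
  refine (integrable_inv_one_add_sq.const_mul (5 / 2)).mono'
    continuous_fejer.aestronglyMeasurable (.of_forall fun v ↦ ?_)
  rw [Real.norm_of_nonneg (fejer_nonneg v)]
  exact fejer_le v

lemma integral_fejer_pos : 0 < ∫ v, fejer v :=
  (MeasureTheory.integral_pos_iff_support_of_nonneg fejer_nonneg integrable_fejer).mpr <|
    continuous_fejer.isOpen_support.measure_pos _ ⟨0, by simp [fejer]⟩

lemma integral_one_sub_mul_cos (v : ℝ) :
    ∫ ξ in (0 : ℝ)..1, (1 - ξ) * Real.cos (ξ * v) = fejer v := by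
  rcases eq_or_ne v 0 with rfl | hv
  · simp only [mul_zero, Real.cos_zero, mul_one, fejer, zero_div, Real.sinc_zero]
    rw [intervalIntegral.integral_sub (by simp) (by simp)]
    norm_num
  have hd (ξ : ℝ) : HasDerivAt
      (fun ξ ↦ (1 - ξ) * (Real.sin (ξ * v) / v) - Real.cos (ξ * v) / v ^ 2)
      ((1 - ξ) * Real.cos (ξ * v)) ξ := by
    have hl : HasDerivAt (fun ξ : ℝ ↦ ξ * v) v ξ := by simpa using (hasDerivAt_id ξ).mul_const v
    have h1 := ((hasDerivAt_id ξ).const_sub 1).mul (hl.sin.div_const v)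
    convert! h1.sub (hl.cos.div_const (v ^ 2)) using 1
    simp only [id]
    field_simp
    ring
  rw [intervalIntegral.integral_eq_sub_of_hasDerivAt (fun ξ _ ↦ hd ξ)
    (Continuous.intervalIntegrable (by fun_prop) _ _), fejer_of_ne_zero hv]
  simp
  ring

open MeasureTheory Topology

section Tauberian

variable {h : ℝ → ℝ} {C : ℝ} {G : ℂ → ℂ}

lemma integrable_mul_exp_neg (hm : Measurable h) (hC : ∀ u, |h u| ≤ C) (h0 : ∀ u < 0, h u = 0)
    {δ : ℝ} (hδ : 0 < δ) : Integrable fun u ↦ h u * Real.exp (-δ * u) := by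
  have hi : IntegrableOn (fun u ↦ C * Real.exp (-δ * u)) (Set.Ici 0) :=
    (Iff.mpr integrableOn_Ici_iff_integrableOn_Ioi (exp_neg_integrableOn_Ioi 0 hδ)).const_mul C
  refine (hi.integrable_indicator measurableSet_Ici).mono'
    (hm.mul (by fun_prop)).aestronglyMeasurable (.of_forall fun u ↦ ?_)
  rcases lt_or_ge u 0 with hu | hu
  · simp [h0 u hu, hu]
  · rw [Set.indicator_of_mem (Set.mem_Ici.mpr hu), Real.norm_eq_abs, abs_mul, Real.abs_exp]
    gcongr
    exact hC u

lemma integral_mul_exp_mul_fejer (hm : Measurable h) (hC : ∀ u, |h u| ≤ C)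
    (h0 : ∀ u < 0, h u = 0)
    (hG : ∀ z : ℂ, 0 < z.re → ∫ u : ℝ, (h u : ℂ) * Complex.exp (-z * u) = G z)
    {δ : ℝ} (hδ : 0 < δ) (l t : ℝ) :
    ∫ u, h u * Real.exp (-δ * u) * fejer (l * (t - u)) =
      ∫ ξ in (0 : ℝ)..1, (1 - ξ) *
        (Complex.exp ((l * ξ * t : ℝ) * Complex.I) * G (δ + (l * ξ : ℝ) * Complex.I)).re := by
  have hi := integrable_mul_exp_neg hm hC h0 hδ
  have hinner (ξ : ℝ) : ∫ u, h u * Real.exp (-δ * u) * Real.cos (ξ * (l * (t - u))) =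
      (Complex.exp ((l * ξ * t : ℝ) * Complex.I) * G (δ + (l * ξ : ℝ) * Complex.I)).re := by
    rw [← hG _ (by simpa using hδ), ← integral_const_mul, ← Complex.reCLM_apply,
      ← ContinuousLinearMap.integral_comp_comm]
    · congr with u
      rw [Complex.reCLM_apply, mul_left_comm (Complex.exp _), ← Complex.exp_add, Complex.re_ofReal_mul,
        Complex.exp_re, mul_assoc]
      congr 3
      · simp
      · simp
        ring
    · refine (hi.ofReal (𝕜 := ℂ)).mono (by fun_prop) (.of_forall fun u ↦ ?_)
      simp [Complex.norm_exp]
  simp_rw [← integral_one_sub_mul_cos, ← intervalIntegral.integral_const_mul,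
    intervalIntegral.integral_of_le zero_le_one]
  rw [integral_integral_swap]
  · refine integral_congr_ae (.of_forall fun ξ ↦ ?_)
    simp only
    rw [← hinner, ← integral_const_mul]
    congr with u
    ring
  · have hp := hi.mul_prod (μ := volume) (ν := volume.restrict (Set.Ioc (0 : ℝ) 1))
      (f := fun u ↦ h u * Real.exp (-δ * u)) (g := fun ξ : ℝ ↦ (1 - ξ))
      ((Continuous.integrableOn_Icc (by fun_prop)).mono_set Set.Ioc_subset_Icc_self)
    refine hp.mono (by unfold Function.uncurry; fun_prop) (.of_forall fun p ↦ ?_)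
    simp only [Function.uncurry, norm_mul, ← mul_assoc]
    exact mul_le_of_le_one_right (by positivity) (Real.abs_cos_le_one _)

lemma integral_mul_fejer (hm : Measurable h) (hC : ∀ u, |h u| ≤ C)
    (h0 : ∀ u < 0, h u = 0) (hGc : ContinuousOn G {z | 0 ≤ z.re})
    (hG : ∀ z : ℂ, 0 < z.re → ∫ u : ℝ, (h u : ℂ) * Complex.exp (-z * u) = G z)
    {l : ℝ} (hl : 0 < l) (t : ℝ) :
    ∫ u, h u * fejer (l * (t - u)) =
      ∫ ξ in (0 : ℝ)..1, (1 - ξ) *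
        (Complex.exp ((l * ξ * t : ℝ) * Complex.I) * G ((l * ξ : ℝ) * Complex.I)).re := by
  have hev : ∀ᶠ δ : ℝ in 𝓝[>] 0, δ ∈ Set.Ioc 0 1 := Ioc_mem_nhdsGT one_pos
  have hKi : Integrable fun u ↦ fejer (l * (t - u)) :=
    ((integrable_fejer.comp_mul_left' hl.ne').comp_sub_left t)
  have hGpath : ContinuousOn (fun p : ℝ × ℝ ↦ G (p.1 + (l * p.2 : ℝ) * Complex.I))
      (Set.Icc 0 1 ×ˢ Set.Icc 0 1) :=
    hGc.comp (by fun_prop) fun p hp ↦ by simpa using hp.1.1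
  obtain ⟨B, hB⟩ := (isCompact_Icc.prod isCompact_Icc).exists_bound_of_continuousOn hGpath
  have hleft : Tendsto (fun δ : ℝ ↦ ∫ u, h u * Real.exp (-δ * u) * fejer (l * (t - u)))
      (𝓝[>] 0) (𝓝 (∫ u, h u * fejer (l * (t - u)))) := by
    refine tendsto_integral_filter_of_dominated_convergence (fun u ↦ C * fejer (l * (t - u)))
      (.of_forall fun δ ↦ ?_) (hev.mono fun δ hδ ↦ .of_forall fun u ↦ ?_)
      (hKi.const_mul C) (.of_forall fun u ↦ ?_)
    · have := continuous_fejer.measurable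
      exact Measurable.aestronglyMeasurable (by fun_prop)
    · rw [norm_mul, norm_mul, Real.norm_of_nonneg (fejer_nonneg _)]
      gcongr
      · exact fejer_nonneg _
      · rcases lt_or_ge u 0 with hu | hu
        · simpa [h0 u hu] using (abs_nonneg _).trans (hC u)
        · refine (mul_le_of_le_one_right (norm_nonneg _) ?_).trans (hC u)
          rw [Real.norm_eq_abs, Real.abs_exp, Real.exp_le_one_iff]
          nlinarith [hδ.1]
    · have : Continuous fun δ : ℝ ↦ h u * Real.exp (-δ * u) * fejer (l * (t - u)) := by fun_prop
      simpa using (this.tendsto 0).mono_left nhdsWithin_le_nhds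
  have hright : Tendsto (fun δ : ℝ ↦ ∫ ξ in (0 : ℝ)..1, (1 - ξ) *
        (Complex.exp ((l * ξ * t : ℝ) * Complex.I) * G (δ + (l * ξ : ℝ) * Complex.I)).re)
      (𝓝[>] 0) (𝓝 (∫ ξ in (0 : ℝ)..1, (1 - ξ) *
        (Complex.exp ((l * ξ * t : ℝ) * Complex.I) * G ((l * ξ : ℝ) * Complex.I)).re)) := by
    have hIoc : Set.uIoc (0 : ℝ) 1 = Set.Ioc 0 1 := Set.uIoc_of_le zero_le_one
    refine intervalIntegral.tendsto_integral_filter_of_dominated_convergence (fun _ ↦ B)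
      (hev.mono fun δ hδ ↦ ?_) (hev.mono fun δ hδ ↦ .of_forall fun ξ hξ ↦ ?_) (by simp)
      (.of_forall fun ξ hξ ↦ ?_)
    · rw [hIoc]
      refine ContinuousOn.aestronglyMeasurable ?_ measurableSet_Ioc
      have : ContinuousOn (fun ξ : ℝ ↦ G (δ + (l * ξ : ℝ) * Complex.I)) (Set.Ioc 0 1) :=
        hGc.comp (by fun_prop) fun p hp ↦ by simpa using hδ.1.le
      refine ContinuousOn.mul (by fun_prop) (Complex.continuous_re.comp_continuousOn ?_)
      exact ContinuousOn.mul (by fun_prop) this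
    · rw [hIoc] at hξ
      rw [norm_mul, ← one_mul B]
      gcongr
      · rw [Real.norm_eq_abs, abs_le]
        constructor <;> linarith [hξ.1, hξ.2]
      · refine (Complex.abs_re_le_norm _).trans ?_
        rw [norm_mul, Complex.norm_exp_ofReal_mul_I, one_mul]
        exact hB (δ, ξ) ⟨⟨hδ.1.le, hδ.2⟩, hξ.1.le, hξ.2⟩
    · have h1 : Tendsto (fun δ : ℝ ↦ (δ + (l * ξ : ℝ) * Complex.I : ℂ)) (𝓝[>] 0)
          (𝓝[{z | 0 ≤ z.re}] ((l * ξ : ℝ) * Complex.I)) := by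
        refine tendsto_nhdsWithin_iff.mpr ⟨?_, hev.mono fun δ hδ ↦ by simpa using hδ.1.le⟩
        have : Continuous fun δ : ℝ ↦ (δ + (l * ξ : ℝ) * Complex.I : ℂ) := by fun_prop
        simpa using (this.tendsto 0).mono_left nhdsWithin_le_nhds
      have h2 := (hGc ((l * ξ : ℝ) * Complex.I) (by simp)).tendsto.comp h1
      exact ((Complex.continuous_re.tendsto _).comp (h2.const_mul _)).const_mul _
  refine tendsto_nhds_unique hleft (hright.congr' (hev.mono fun δ hδ ↦ ?_))
  exact (integral_mul_exp_mul_fejer hm hC h0 hG hδ.1 l t).symm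

lemma tendsto_integral_mul_fejer (hm : Measurable h) (hC : ∀ u, |h u| ≤ C)
    (h0 : ∀ u < 0, h u = 0) (hGc : ContinuousOn G {z | 0 ≤ z.re})
    (hG : ∀ z : ℂ, 0 < z.re → ∫ u : ℝ, (h u : ℂ) * Complex.exp (-z * u) = G z)
    {l : ℝ} (hl : 0 < l) :
    Tendsto (fun t ↦ ∫ u, h u * fejer (l * (t - u))) atTop (𝓝 0) := by
  simp_rw [integral_mul_fejer hm hC h0 hGc hG hl]
  set f : ℝ → ℂ := (Set.Ioc (0 : ℝ) 1).indicator
    fun ξ ↦ ((1 - ξ : ℝ) : ℂ) * G ((l * ξ : ℝ) * Complex.I) with hf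
  have hfi : Integrable f := by
    refine IntegrableOn.integrable_indicator ?_ measurableSet_Ioc
    refine (ContinuousOn.integrableOn_Icc ?_).mono_set Set.Ioc_subset_Icc_self
    exact ContinuousOn.mul (by fun_prop) (hGc.comp (by fun_prop) fun p hp ↦ by simp)
  have hs : Tendsto (fun t : ℝ ↦ -(l / (2 * Real.pi)) * t) atTop atBot :=
    tendsto_id.const_mul_atTop_of_neg (by simp; positivity)
  have hrl := ((Real.tendsto_integral_exp_smul_cocompact f).mono_left atBot_le_cocompact).comp hs
  have := (Complex.continuous_re.tendsto _).comp hrl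
  rw [Complex.zero_re] at this
  refine this.congr fun t ↦ ?_
  simp only [Function.comp_apply]
  rw [← Complex.reCLM_apply, ← ContinuousLinearMap.integral_comp_comm,
    intervalIntegral.integral_of_le zero_le_one, ← integral_indicator measurableSet_Ioc]
  · congr with ξ
    by_cases hξ : ξ ∈ Set.Ioc (0 : ℝ) 1
    · rw [hf, Set.indicator_of_mem hξ, Set.indicator_of_mem hξ, Circle.smul_def,
        Real.fourierChar_apply, smul_eq_mul, mul_left_comm, Complex.reCLM_apply,
        Complex.re_ofReal_mul]
      congr 5
      push_cast
      field_simp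
    · simp [hf, Set.indicator_of_notMem hξ]
  · have := (Real.fourierIntegral_convergent_iff (-(l / (2 * Real.pi)) * t)).mpr hfi
    simpa only [mul_comm, RCLike.inner_apply, conj_trivial] using this

lemma exists_setIntegral_fejer_le {ε : ℝ} (hε : 0 < ε) :
    ∃ A : ℝ, 0 < A ∧ ∫ v in {v | A < |v|}, fejer v ≤ ε := by
  have hlim : Tendsto (fun A : ℝ ↦ ∫ v, {v | A < |v|}.indicator fejer v) atTop
      (𝓝 (∫ _ : ℝ, (0 : ℝ))) := by
    refine tendsto_integral_filter_of_dominated_convergence fejer (.of_forall fun A ↦ ?_)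
      (.of_forall fun A ↦ .of_forall fun v ↦ ?_) integrable_fejer (.of_forall fun v ↦ ?_)
    · exact (continuous_fejer.measurable.indicator
        (measurableSet_lt (by fun_prop) (by fun_prop))).aestronglyMeasurable
    · refine (norm_indicator_le_norm_self _ _).trans_eq ?_
      exact Real.norm_of_nonneg (fejer_nonneg v)
    · refine tendsto_const_nhds.congr' ?_
      filter_upwards [eventually_ge_atTop |v|] with A hA
      simp [hA]
  rw [integral_zero] at hlim
  obtain ⟨A, hA, hA0⟩ := ((hlim.eventually_le_const hε).and (eventually_gt_atTop 0)).exists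
  refine ⟨A, hA0, ?_⟩
  rwa [integral_indicator (measurableSet_lt (by fun_prop) (by fun_prop))] at hA

/-- A Tauberian theorem: a bounded slowly oscillating function whose Laplace transform extends
continuously to the closed half plane tends to zero. -/
theorem tendsto_zero_of_laplace_continuousOn (hm : Measurable h) (hC : ∀ u, |h u| ≤ C)
    (h0 : ∀ u < 0, h u = 0) (hGc : ContinuousOn G {z | 0 ≤ z.re})
    (hG : ∀ z : ℂ, 0 < z.re → ∫ u : ℝ, (h u : ℂ) * Complex.exp (-z * u) = G z)
    (hosc : ∀ ε > 0, ∃ η > 0, ∃ T, ∀ t ≥ T, ∀ s, |s| ≤ η → |h (t - s) - h t| ≤ ε) :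
    Tendsto h atTop (𝓝 0) := by
  set c := ∫ v, fejer v with hc
  have hc0 : 0 < c := integral_fejer_pos
  have hC0 : 0 ≤ C := (abs_nonneg _).trans (hC 0)
  suffices H : ∀ ε > 0, ∀ᶠ t in atTop, c * |h t| ≤ (c + 2 * C + 1) * ε by
    rw [Metric.tendsto_nhds]
    intro ε hε
    filter_upwards [H (c * (ε / 2) / (c + 2 * C + 1)) (by positivity)] with t ht
    rw [mul_div_cancel₀ _ (by positivity : c + 2 * C + 1 ≠ 0)] at ht
    rw [dist_zero_right, Real.norm_eq_abs]
    linarith [le_of_mul_le_mul_left ht hc0]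
  intro ε hε
  obtain ⟨η, hη, T, hT⟩ := hosc ε hε
  obtain ⟨A, hA, hAε⟩ := exists_setIntegral_fejer_le hε
  set l := A / η with hl
  have hl0 : 0 < l := by positivity
  have hlim := (tendsto_integral_mul_fejer hm hC h0 hGc hG hl0).const_mul l
  rw [mul_zero] at hlim
  filter_upwards [(tendsto_zero_iff_norm_tendsto_zero.mp hlim).eventually_le_const hε,
    eventually_ge_atTop T] with t ht htT
  have hsub : l * ∫ u, h u * fejer (l * (t - u)) = ∫ v, h (t - v / l) * fejer v := by
    have h1 := integral_sub_left_eq_self (fun s ↦ h (t - s) * fejer (l * s)) volume t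
    have h2 := Measure.integral_comp_div (fun v ↦ h (t - v) * fejer (l * v)) l
    simp only [sub_sub_cancel] at h1
    rw [abs_of_pos hl0, smul_eq_mul] at h2
    rw [h1, ← h2]
    congr with v
    rw [mul_div_cancel₀ _ hl0.ne']
  rw [hsub, Real.norm_eq_abs] at ht
  have hS : MeasurableSet {v : ℝ | A < |v|} := measurableSet_lt (by fun_prop) (by fun_prop)
  have hi1 : Integrable fun v ↦ h (t - v / l) * fejer v := by
    refine (integrable_fejer.const_mul C).mono' ?_ (.of_forall fun v ↦ ?_)
    · have := continuous_fejer.measurable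
      exact Measurable.aestronglyMeasurable (by fun_prop)
    · rw [norm_mul, Real.norm_of_nonneg (fejer_nonneg _)]
      exact mul_le_mul_of_nonneg_right (hC _) (fejer_nonneg _)
  have hi2 : Integrable fun v ↦ h t * fejer v := integrable_fejer.const_mul _
  have hdiff : |∫ v, (h (t - v / l) * fejer v - h t * fejer v)| ≤ c * ε + 2 * C * ε := by
    have hpt (v : ℝ) : |h (t - v / l) * fejer v - h t * fejer v| ≤
        ε * fejer v + 2 * C * {v | A < |v|}.indicator fejer v := by
      rw [← sub_mul, abs_mul, abs_of_nonneg (fejer_nonneg v)]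
      have hK := fejer_nonneg v
      by_cases hv : A < |v|
      · rw [Set.indicator_of_mem (by exact hv)]
        have : |h (t - v / l) - h t| ≤ 2 * C := by
          linarith [abs_sub (h (t - v / l)) (h t), hC (t - v / l), hC t]
        nlinarith
      · rw [Set.indicator_of_notMem (by exact hv), mul_zero, add_zero]
        refine mul_le_mul_of_nonneg_right (hT t htT _ ?_) hK
        rw [abs_div, abs_of_pos hl0, div_le_iff₀ hl0, hl, mul_div_cancel₀ _ hη.ne']
        exact not_lt.mp hv
    have hind := (integrable_fejer.indicator hS).const_mul (2 * C)
    calc _ ≤ ∫ v, (ε * fejer v + 2 * C * {v | A < |v|}.indicator fejer v) :=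
          (abs_integral_le_integral_abs).trans <| integral_mono (hi1.sub hi2).abs
            ((integrable_fejer.const_mul ε).add hind) hpt
      _ = c * ε + 2 * C * ∫ v in {v | A < |v|}, fejer v := by
          rw [integral_add (integrable_fejer.const_mul ε) hind, integral_const_mul,
            integral_const_mul, integral_indicator hS, mul_comm ε]
      _ ≤ _ := by gcongr
  rw [integral_sub hi1 hi2, integral_const_mul, ← hc] at hdiff
  have := abs_sub_abs_le_abs_sub (h t * c) (∫ v, h (t - v / l) * fejer v)
  rw [abs_sub_comm, abs_mul, abs_of_pos hc0] at this
  linarith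

end Tauberian

section Summatory

variable {a : ℕ → ℝ} {G : ℂ → ℂ}

lemma abs_sum_Ioc_le (ha : ∀ n, |a n| ≤ 1) (m n : ℕ) :
    |∑ k ∈ Finset.Ioc m n, a k| ≤ (n - m : ℕ) := by
  refine (Finset.abs_sum_le_sum_abs _ _).trans ((Finset.sum_le_sum fun k _ ↦ ha k).trans_eq ?_)
  simp

lemma abs_sum_Icc_floor_le (ha : ∀ n, |a n| ≤ 1) {x : ℝ} (hx : 0 ≤ x) :
    |∑ k ∈ Finset.Icc 1 ⌊x⌋₊, a k| ≤ x :=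
  (abs_sum_Ioc_le ha 0 _).trans (by simpa using Nat.floor_le hx)

lemma abs_sum_Icc_floor_sub_le (ha : ∀ n, |a n| ≤ 1) {x y : ℝ} (hx : 0 ≤ x) (hy : 0 ≤ y) :
    |∑ k ∈ Finset.Icc 1 ⌊x⌋₊, a k - ∑ k ∈ Finset.Icc 1 ⌊y⌋₊, a k| ≤ |x - y| + 1 := by
  wlog hxy : y ≤ x generalizing x y
  · rw [abs_sub_comm, abs_sub_comm x]
    exact this hy hx (le_of_not_ge hxy)
  have hfl := Nat.floor_le_floor hxy
  have hsplit : ∑ k ∈ Finset.Icc 1 ⌊x⌋₊, a k =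
      ∑ k ∈ Finset.Icc 1 ⌊y⌋₊, a k + ∑ k ∈ Finset.Ioc ⌊y⌋₊ ⌊x⌋₊, a k :=
    (Finset.sum_Ioc_consecutive a (Nat.zero_le _) hfl).symm
  rw [hsplit, add_sub_cancel_left, abs_of_nonneg (sub_nonneg.mpr hxy)]
  refine (abs_sum_Ioc_le ha _ _).trans ?_
  rw [Nat.cast_sub hfl]
  linarith [Nat.floor_le hx, Nat.lt_floor_add_one y]

/-- A bounded sequence whose Dirichlet series, divided by `s`, extends continuously to the closed
half plane `1 ≤ s.re` has mean value zero. -/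
theorem tendsto_sum_div_of_LSeries_continuousOn (ha : ∀ n, |a n| ≤ 1)
    (hGc : ContinuousOn G {z | 0 ≤ z.re})
    (hG : ∀ z : ℂ, 0 < z.re → LSeries (fun n ↦ (a n : ℂ)) (1 + z) = (1 + z) * G z) :
    Tendsto (fun x : ℝ ↦ (∑ k ∈ Finset.Icc 1 ⌊x⌋₊, a k) / x) atTop (𝓝 0) := by
  set h : ℝ → ℝ := fun u ↦ (∑ k ∈ Finset.Icc 1 ⌊Real.exp u⌋₊, a k) * Real.exp (-u) with hh
  suffices H : Tendsto h atTop (𝓝 0) by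
    refine (H.comp Real.tendsto_log_atTop).congr' ?_
    filter_upwards [eventually_gt_atTop 0] with x hx
    simp [hh, Real.exp_neg, Real.exp_log hx, div_eq_mul_inv]
  have h0 : ∀ u < 0, h u = 0 := fun u hu ↦ by
    simp [hh, Nat.floor_eq_zero.mpr (Real.exp_lt_one_iff.mpr hu)]
  refine tendsto_zero_of_laplace_continuousOn (C := 1) ?_ (fun u ↦ ?_) h0 hGc
    (fun z hz ↦ ?_) (fun ε hε ↦ ?_)
  · have : Measurable fun n : ℕ ↦ ∑ k ∈ Finset.Icc 1 n, a k := measurable_from_top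
    exact (this.comp (Nat.measurable_floor.comp Real.measurable_exp)).mul (by fun_prop)
  · rw [hh, abs_mul, Real.abs_exp]
    calc _ ≤ Real.exp u * Real.exp (-u) := by
          gcongr
          exact abs_sum_Icc_floor_le ha (Real.exp_pos u).le
      _ = 1 := by rw [← Real.exp_add]; simp
  · have hz1 : (1 + z) ≠ 0 := fun h ↦ by
      have := congrArg Complex.re h
      simp at this
      linarith
    have hO : (fun n : ℕ ↦ ∑ k ∈ Finset.Icc 1 n, ‖(a k : ℂ)‖) =O[atTop]
        fun n ↦ (n : ℝ) ^ (1 : ℝ) := by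
      refine Asymptotics.isBigO_of_le _ fun n ↦ ?_
      rw [Real.norm_of_nonneg (by positivity), Real.rpow_one, Real.norm_natCast]
      refine (Finset.sum_le_sum (g := fun _ ↦ 1) fun k _ ↦ by simpa using ha k).trans_eq (by simp)
    have hL := LSeries_eq_mul_integral' (fun n ↦ (a n : ℂ)) zero_le_one
      (s := 1 + z) (by simpa using hz) hO
    rw [hG z hz] at hL
    rw [mul_left_cancel₀ hz1 hL, ← Real.exp_zero, ← integral_comp_exp_Ioi,
      ← integral_Ici_eq_integral_Ioi, setIntegral_eq_integral_of_forall_compl_eq_zero]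
    · congr with u
      have : ((Real.exp u : ℝ) : ℂ) ^ (-(1 + z + 1)) =
          Complex.exp (-u) * Complex.exp (-z * u) * Complex.exp (-u) := by
        rw [Complex.cpow_def_of_ne_zero (by simp), ← Complex.ofReal_log (Real.exp_pos u).le,
          Real.log_exp, ← Complex.exp_add, ← Complex.exp_add]
        congr 1
        ring
      rw [hh, this, Complex.real_smul]
      push_cast
      rw [Complex.exp_neg (u : ℂ)]
      field_simp
    · intro u hu
      simp [Nat.floor_eq_zero.mpr (Real.exp_lt_one_iff.mpr (not_le.mp hu))]
  · obtain ⟨η, hη, hηε⟩ : ∃ η > 0, ∀ s : ℝ, |s| ≤ η → |Real.exp (-s) - 1| ≤ ε / 3 := by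
      have hcont : Continuous fun s ↦ |Real.exp (-s) - 1| := by fun_prop
      have := (hcont.tendsto' 0 0 (by simp)).eventually_le_const
        (by positivity : 0 < ε / 3)
      obtain ⟨η, hη, hb⟩ := Metric.nhds_basis_closedBall.eventually_iff.mp this
      exact ⟨η, hη, fun s hs ↦ hb (by simpa using hs)⟩
    obtain ⟨T, hT⟩ := eventually_atTop.mp
      (Real.tendsto_exp_neg_atTop_nhds_zero.eventually_le_const (by positivity : 0 < ε / 3))
    refine ⟨η, hη, T, fun t ht s hs ↦ ?_⟩
    have hes := hηε s hs
    set S : ℝ → ℝ := fun x ↦ ∑ k ∈ Finset.Icc 1 ⌊x⌋₊, a k with hS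
    have hexp : Real.exp (t - s) = Real.exp t * Real.exp (-s) := by
      rw [← Real.exp_add, sub_eq_add_neg]
    have hprod : Real.exp t * Real.exp (-t) = 1 := by rw [← Real.exp_add]; simp
    have hprod' : Real.exp s * Real.exp (-s) = 1 := by rw [← Real.exp_add]; simp
    have hinv : Real.exp (-(t - s)) = Real.exp (-t) * Real.exp s := by
      rw [← Real.exp_add]; congr 1; ring
    have e1 : |S (Real.exp (t - s)) * (Real.exp (-(t - s)) - Real.exp (-t))| ≤ ε / 3 := by
      rw [abs_mul]
      calc _ ≤ Real.exp (t - s) * |Real.exp (-(t - s)) - Real.exp (-t)| := by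
            gcongr
            exact abs_sum_Icc_floor_le ha (Real.exp_pos _).le
        _ = |Real.exp (-s) - 1| := by
            rw [← Real.abs_exp (t - s), ← abs_mul, abs_sub_comm]
            congr 1
            rw [hexp, hinv]
            linear_combination (Real.exp s * Real.exp (-s) - Real.exp (-s)) * hprod + hprod'
        _ ≤ _ := hes
    have e2 : |(S (Real.exp (t - s)) - S (Real.exp t)) * Real.exp (-t)| ≤ ε / 3 + ε / 3 := by
      rw [abs_mul, Real.abs_exp]
      calc _ ≤ (|Real.exp (t - s) - Real.exp t| + 1) * Real.exp (-t) := by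
            gcongr
            exact abs_sum_Icc_floor_sub_le ha (Real.exp_pos _).le (Real.exp_pos _).le
        _ = |Real.exp (-s) - 1| + Real.exp (-t) := by
            rw [add_mul, one_mul, ← Real.abs_exp (-t), ← abs_mul]
            congr 2
            rw [hexp]
            linear_combination (Real.exp (-s) - 1) * hprod
        _ ≤ _ := add_le_add hes (hT t ht)
    calc |h (t - s) - h t|
        = |S (Real.exp (t - s)) * (Real.exp (-(t - s)) - Real.exp (-t)) +
            (S (Real.exp (t - s)) - S (Real.exp t)) * Real.exp (-t)| := by
          congr 1
          simp only [hh, hS]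
          ring
      _ ≤ _ := (abs_add_le _ _).trans (by linarith)

end Summatory

section Moebius

open ArithmeticFunction DirichletCharacter

/-- The Möbius function restricted to the integers coprime to `r`. -/
def moebiusCoprime (r n : ℕ) : ℤ := if n.Coprime r then moebius n else 0

lemma abs_moebiusCoprime_le (r n : ℕ) : |(moebiusCoprime r n : ℝ)| ≤ 1 := by
  unfold moebiusCoprime
  split_ifs
  · exact_mod_cast abs_moebius_le_one
  · simp

lemma LSeries_moebiusCoprime (r : ℕ) [NeZero r] {s : ℂ} (hs : 1 < s.re) :
    LFunctionTrivChar r s * LSeries (fun n ↦ (moebiusCoprime r n : ℂ)) s = 1 := by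
  rw [← LSeries.mul_mu_eq_one (1 : DirichletCharacter ℂ r) hs, LFunctionTrivChar,
    LFunction_eq_LSeries _ hs]
  congr 2
  ext n
  by_cases hn : n.Coprime r
  · simp [moebiusCoprime, hn, MulChar.one_apply ((ZMod.isUnit_iff_coprime n r).mpr hn)]
  · simp [moebiusCoprime, hn, MulChar.map_nonunit _ (mt (ZMod.isUnit_iff_coprime n r).mp hn)]

lemma LFunctionTrivChar₁_ne_zero (r : ℕ) [NeZero r] {s : ℂ} (hs : 1 ≤ s.re) :
    LFunctionTrivChar₁ r s ≠ 0 := by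
  rcases eq_or_ne s 1 with rfl | hs1
  · exact LFunctionTrivChar₁_apply_one_ne_zero r
  · rw [LFunctionTrivChar₁, Function.update_of_ne hs1]
    exact mul_ne_zero (sub_ne_zero.mpr hs1) (LFunction_ne_zero_of_one_le_re _ (.inr hs1) hs)

theorem tendsto_sum_moebiusCoprime_div (r : ℕ) [NeZero r] :
    Tendsto (fun x : ℝ ↦ (∑ k ∈ Finset.Icc 1 ⌊x⌋₊, (moebiusCoprime r k : ℝ)) / x) atTop
      (𝓝 0) := by
  have hne {z : ℂ} (hz : 0 ≤ z.re) : 1 + z ≠ 0 := fun h ↦ by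
    have := congrArg Complex.re h
    simp at this
    linarith
  refine tendsto_sum_div_of_LSeries_continuousOn (abs_moebiusCoprime_le r)
    (G := fun z ↦ z / ((1 + z) * LFunctionTrivChar₁ r (1 + z))) ?_ fun z hz ↦ ?_
  · have hc := (differentiable_LFunctionTrivChar₁ r).continuous
    exact ContinuousOn.div (by fun_prop) (by fun_prop) fun z hz ↦
      mul_ne_zero (hne hz) (LFunctionTrivChar₁_ne_zero r (by simpa using hz))
  · have hz0 : z ≠ 0 := fun h ↦ by simp [h] at hz
    have hL := LSeries_moebiusCoprime r (s := 1 + z) (by simpa using hz)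
    have h1 : LFunctionTrivChar₁ r (1 + z) = z * LFunctionTrivChar r (1 + z) := by
      rw [LFunctionTrivChar₁, Function.update_of_ne (by simpa using hz0), add_sub_cancel_left]
    have := left_ne_zero_of_mul_eq_one hL
    have := hne hz.le
    simp only [Complex.ofReal_intCast]
    rw [eq_div_of_mul_eq ‹_› ((mul_comm _ _).trans hL), h1]
    field_simp

end Moebius

section Squarefree

open Finset ArithmeticFunction

lemma Nat.sq_dvd_sq_mul_iff {b s d : ℕ} (hs : Squarefree s) (hb : b ≠ 0) :
    d ^ 2 ∣ b ^ 2 * s ↔ d ∣ b := by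
  refine ⟨fun h ↦ ?_, fun h ↦ (pow_dvd_pow_of_dvd h 2).mul_right s⟩
  obtain ⟨g, d', b', hg, hcop, rfl, rfl⟩ := Nat.exists_coprime' (Nat.gcd_pos_of_pos_right d hb.bot_lt)
  rw [mul_pow, mul_pow, mul_right_comm] at h
  have h1 := (hcop.pow 2 2).dvd_of_dvd_mul_left (Nat.dvd_of_mul_dvd_mul_right (by positivity) h)
  rw [Nat.isUnit_iff.mp (hs d' (by rwa [← sq])), one_mul]
  exact dvd_mul_left g b'

lemma sum_moebius_divisors (n : ℕ) : ∑ d ∈ n.divisors, moebius d = if n = 1 then 1 else 0 := by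
  rw [← coe_mul_zeta_apply, moebius_mul_coe_zeta, one_apply]

lemma sum_moebius_sq_dvd {m N : ℕ} (hm : m ≠ 0) (hmN : m ≤ N) :
    ∑ d ∈ Icc 1 N with d ^ 2 ∣ m, moebius d = if Squarefree m then 1 else 0 := by
  obtain ⟨s, b, rfl, hs⟩ := Nat.sq_mul_squarefree m
  have hb : b ≠ 0 := by rintro rfl; simp at hm
  have hs0 : s ≠ 0 := hs.ne_zero
  have hbN : b ≤ N := by
    refine le_trans ?_ hmN
    calc b ≤ b ^ 2 := Nat.le_self_pow two_ne_zero b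
      _ ≤ b ^ 2 * s := Nat.le_mul_of_pos_right _ hs0.bot_lt
  have hsq : Squarefree (b ^ 2 * s) ↔ b = 1 := by
    refine ⟨fun h ↦ ?_, fun h ↦ by simpa [h] using hs⟩
    exact Nat.isUnit_iff.mp (h b (by rw [← sq]; exact dvd_mul_right _ _))
  have hfil : {d ∈ Icc 1 N | d ^ 2 ∣ b ^ 2 * s} = b.divisors := by
    ext d
    simp only [mem_filter, mem_Icc, Nat.sq_dvd_sq_mul_iff hs hb, Nat.mem_divisors]
    refine ⟨fun h ↦ ⟨h.2, hb⟩, fun h ↦ ⟨⟨Nat.pos_of_dvd_of_pos h.1 hb.bot_lt, ?_⟩, h.1⟩⟩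
    exact (Nat.le_of_dvd hb.bot_lt h.1).trans hbN
  rw [hfil, sum_moebius_divisors]
  simp [hsq]

/-- The number of positive integers up to `N` coprime to `r`. -/
def coprimeCount (r N : ℕ) : ℕ := #{m ∈ Icc 1 N | m.Coprime r}

lemma coprimeCount_le (r N : ℕ) : coprimeCount r N ≤ N :=
  (card_filter_le _ _).trans_eq (by simp)

lemma coprimeCount_add_self (r N : ℕ) :
    coprimeCount r (N + r) = coprimeCount r N + r.totient := by
  have hIoc : ∀ M, Icc 1 M = Ico 1 (M + 1) := fun M ↦ by ext; simp
  rw [coprimeCount, coprimeCount, hIoc, hIoc, ← Nat.filter_coprime_Ico_eq_totient r (N + 1),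
    ← Ico_union_Ico_eq_Ico (show 1 ≤ N + 1 by omega) (show N + 1 ≤ N + r + 1 by omega),
    filter_union, card_union_of_disjoint
      (disjoint_filter_filter (Ico_disjoint_Ico_consecutive _ _ _))]
  simp only [Nat.coprime_comm, add_right_comm]

lemma abs_coprimeCount_sub_le {r : ℕ} (hr : r ≠ 0) (N : ℕ) :
    |(coprimeCount r N : ℝ) - r.totient / r * N| ≤ r := by
  have hr' : (0 : ℝ) < r := by exact_mod_cast hr.bot_lt
  induction N using Nat.strong_induction_on with
  | _ N ih =>
    rcases lt_or_ge N r with h | h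
    · have h1 : (r.totient / r : ℝ) ≤ 1 :=
        div_le_one_of_le₀ (by exact_mod_cast r.totient_le) hr'.le
      have h2 : (coprimeCount r N : ℝ) ≤ N := by exact_mod_cast coprimeCount_le r N
      have h3 : (N : ℝ) ≤ r := by exact_mod_cast h.le
      have h4 : (0 : ℝ) ≤ r.totient / r * N := by positivity
      have h5 : (r.totient / r * N : ℝ) ≤ N := mul_le_of_le_one_left (by positivity) h1
      have h6 : (0 : ℝ) ≤ coprimeCount r N := by positivity
      rw [abs_le]
      constructor <;> linarith
    · obtain ⟨M, rfl⟩ := Nat.exists_eq_add_of_le' h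
      have := ih M (by omega)
      rw [coprimeCount_add_self]
      convert! this using 2
      push_cast
      field_simp
      ring

lemma tendsto_coprimeCount_div {r : ℕ} (hr : r ≠ 0) (k : ℕ) :
    Tendsto (fun N : ℕ ↦ (coprimeCount r (N / k) : ℝ) / N) atTop
      (𝓝 (r.totient / r / k)) := by
  have hlim := tendsto_const_div_atTop_nhds_zero_nat (r + 1 : ℝ)
  rw [tendsto_iff_dist_tendsto_zero]
  refine squeeze_zero' (.of_forall fun _ ↦ dist_nonneg) ?_ hlim
  filter_upwards [eventually_gt_atTop 0] with N hN
  have hN' : (0 : ℝ) < N := by exact_mod_cast hN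
  have hr' : (0 : ℝ) < r := by exact_mod_cast hr.bot_lt
  have hρ0 : (0 : ℝ) ≤ r.totient / r := by positivity
  have hρ1 : (r.totient / r : ℝ) ≤ 1 :=
    div_le_one_of_le₀ (by exact_mod_cast r.totient_le) hr'.le
  have h1 := abs_coprimeCount_sub_le hr (N / k)
  have h2 : |((N / k : ℕ) : ℝ) - N / k| ≤ 1 := by
    rw [← Nat.floor_div_eq_div (K := ℝ), abs_le]
    have := Nat.floor_le (show (0 : ℝ) ≤ (N : ℝ) / k by positivity)
    have := Nat.lt_floor_add_one ((N : ℝ) / k)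
    constructor <;> linarith
  have h3 : |(coprimeCount r (N / k) : ℝ) - r.totient / r * (N / k)| ≤ r + 1 := by
    have h4 : |(r.totient / r : ℝ) * (((N / k : ℕ) : ℝ) - N / k)| ≤ 1 := by
      rw [abs_mul, abs_of_nonneg hρ0]
      exact mul_le_one₀ hρ1 (abs_nonneg _) h2
    refine le_trans (le_of_eq ?_) ((abs_add_le _ _).trans (add_le_add h1 h4))
    congr 1
    ring
  rw [Real.dist_eq, le_div_iff₀ hN', ← abs_of_pos hN', ← abs_mul, abs_of_pos hN']
  refine le_trans (le_of_eq ?_) h3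
  congr 1
  field_simp

lemma card_filter_sq_dvd_coprime {r d : ℕ} (hd : d ≠ 0) (N : ℕ) :
    #{m ∈ Icc 1 N | m.Coprime r ∧ d ^ 2 ∣ m} =
      if d.Coprime r then coprimeCount r (N / d ^ 2) else 0 := by
  have hd2 : 0 < d ^ 2 := by positivity
  split_ifs with hdr
  · symm
    refine card_bij (fun m _ ↦ d ^ 2 * m) (fun m hm ↦ ?_) (fun m _ n _ h ↦ ?_) fun m hm ↦ ?_
    · simp only [mem_filter, mem_Icc] at hm ⊢
      refine ⟨⟨Nat.mul_pos hd2 hm.1.1, ?_⟩, (hdr.pow_left 2).mul_left hm.2, dvd_mul_right _ _⟩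
      exact (Nat.mul_le_mul_left _ hm.1.2).trans (Nat.mul_div_le _ _)
    · exact Nat.eq_of_mul_eq_mul_left hd2 h
    · simp only [mem_filter, mem_Icc] at hm
      obtain ⟨⟨h1, h2⟩, h3, n, rfl⟩ := hm
      refine ⟨n, ?_, rfl⟩
      simp only [mem_filter, mem_Icc]
      exact ⟨⟨Nat.pos_of_mul_pos_left h1, (Nat.le_div_iff_mul_le hd2).mpr (by linarith)⟩,
        h3.coprime_mul_left⟩
  · rw [card_eq_zero, filter_eq_empty_iff]
    rintro m - ⟨hm, hdm⟩
    exact hdr (hm.coprime_dvd_left ((dvd_pow_self d two_ne_zero).trans hdm))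

/-- The number of squarefree positive integers up to `N` coprime to `r`. -/
def squarefreeCoprimeCount (r N : ℕ) : ℕ := #{m ∈ Icc 1 N | m.Coprime r ∧ Squarefree m}

lemma squarefreeCoprimeCount_eq (r N : ℕ) :
    (squarefreeCoprimeCount r N : ℤ) =
      ∑ d ∈ Icc 1 N, moebiusCoprime r d * coprimeCount r (N / d ^ 2) := by
  calc (squarefreeCoprimeCount r N : ℤ)
      = ∑ m ∈ Icc 1 N with m.Coprime r, if Squarefree m then 1 else 0 := by
        rw [squarefreeCoprimeCount, sum_boole, filter_filter]
    _ = ∑ m ∈ Icc 1 N with m.Coprime r, ∑ d ∈ Icc 1 N, if d ^ 2 ∣ m then moebius d else 0 := by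
        refine sum_congr rfl fun m hm ↦ ?_
        simp only [mem_filter, mem_Icc] at hm
        rw [← sum_filter, sum_moebius_sq_dvd (by omega) hm.1.2]
    _ = ∑ d ∈ Icc 1 N, moebiusCoprime r d * coprimeCount r (N / d ^ 2) := by
        rw [sum_comm]
        refine sum_congr rfl fun d hd ↦ ?_
        rw [← sum_filter, sum_const, filter_filter,
          card_filter_sq_dvd_coprime (by simp at hd; omega), moebiusCoprime]
        split_ifs <;> simp [mul_comm]

lemma tendsto_squarefreeCoprimeCount_div {r : ℕ} (hr : r ≠ 0) :
    Tendsto (fun N : ℕ ↦ (squarefreeCoprimeCount r N : ℝ) / N) atTop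
      (𝓝 (r.totient / r * ∑' d : ℕ, (moebiusCoprime r d : ℝ) / d ^ 2)) := by
  have hterm (N : ℕ) : (squarefreeCoprimeCount r N : ℝ) / N =
      ∑' d : ℕ, (moebiusCoprime r d : ℝ) * ((coprimeCount r (N / d ^ 2) : ℝ) / N) := by
    rw [tsum_eq_sum (s := Icc 1 N), ← Int.cast_natCast, squarefreeCoprimeCount_eq]
    · push_cast
      rw [sum_div]
      exact sum_congr rfl fun d _ ↦ mul_div_assoc _ _ _
    · intro d hd
      rcases eq_or_ne d 0 with rfl | hd0
      · simp [coprimeCount]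
      · have : N < d ^ 2 := by
          have := Nat.le_self_pow two_ne_zero d
          simp at hd
          omega
        simp [Nat.div_eq_of_lt this, coprimeCount]
  simp_rw [hterm]
  rw [← tsum_mul_left]
  refine tendsto_tsum_of_dominated_convergence (bound := fun d : ℕ ↦ 1 / (d : ℝ) ^ 2)
    (Real.summable_one_div_nat_pow.mpr one_lt_two) (fun d ↦ ?_) (.of_forall fun N d ↦ ?_)
  · have := (tendsto_coprimeCount_div hr (d ^ 2)).const_mul (moebiusCoprime r d : ℝ)
    convert! this using 2
    push_cast
    ring
  · rw [norm_mul, Real.norm_eq_abs, Real.norm_of_nonneg (by positivity)]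
    refine (mul_le_of_le_one_left (by positivity) (abs_moebiusCoprime_le r d)).trans ?_
    refine div_le_of_le_mul₀ (by positivity) (by positivity) ?_
    calc (coprimeCount r (N / d ^ 2) : ℝ) ≤ (N / d ^ 2 : ℕ) := by
          exact_mod_cast coprimeCount_le _ _
      _ ≤ N / (d ^ 2 : ℕ) := Nat.cast_div_le
      _ = 1 / d ^ 2 * N := by push_cast; ring

lemma totient_div_mul_tsum_moebiusCoprime {r : ℕ} (hr : r ≠ 0) :
    r.totient / r * ∑' d : ℕ, (moebiusCoprime r d : ℝ) / d ^ 2 =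
      6 / (Real.pi ^ 2 * ∏ p ∈ r.primeFactors, (1 + 1 / (p : ℝ))) := by
  have : NeZero r := ⟨hr⟩
  set κ := ∑' d : ℕ, (moebiusCoprime r d : ℝ) / d ^ 2 with hκ
  have hL := LSeries_moebiusCoprime r (s := 2) (by simp)
  have hLκ : LSeries (fun n ↦ (moebiusCoprime r n : ℂ)) 2 = (κ : ℂ) := by
    rw [hκ, Complex.ofReal_tsum, LSeries]
    refine tsum_congr fun n ↦ ?_
    rcases eq_or_ne n 0 with rfl | hn
    · simp
    · rw [LSeries.term_of_ne_zero hn]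
      norm_cast
  rw [hLκ, DirichletCharacter.LFunctionTrivChar_eq_mul_riemannZeta (by norm_num),
    riemannZeta_two] at hL
  have hL' : (∏ p ∈ r.primeFactors, (1 - ((p : ℝ) ^ 2)⁻¹)) * (Real.pi ^ 2 / 6) * κ = 1 := by
    rw [← Complex.ofReal_inj, Complex.ofReal_one, ← hL]
    push_cast
    congr 2
    refine prod_congr rfl fun p _ ↦ ?_
    rw [Complex.cpow_neg]
    norm_cast
  have hφ : (r.totient / r : ℝ) = ∏ p ∈ r.primeFactors, (1 - (p : ℝ)⁻¹) := by
    have := Nat.totient_eq_mul_prod_factors r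
    have h2 : (r.totient : ℝ) = r * ∏ p ∈ r.primeFactors, (1 - (p : ℝ)⁻¹) := by
      simpa using congrArg (Rat.cast (K := ℝ)) this
    rw [h2, mul_div_cancel_left₀ _ (by exact_mod_cast hr)]
  have hprod : ∏ p ∈ r.primeFactors, (1 - ((p : ℝ) ^ 2)⁻¹) =
      (∏ p ∈ r.primeFactors, (1 - (p : ℝ)⁻¹)) * ∏ p ∈ r.primeFactors, (1 + 1 / (p : ℝ)) := by
    rw [← prod_mul_distrib]
    refine prod_congr rfl fun p _ ↦ ?_
    rw [← inv_pow, one_div]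
    ring
  have hpos : 0 < ∏ p ∈ r.primeFactors, (1 + 1 / (p : ℝ)) := prod_pos fun p _ ↦ by positivity
  rw [hφ, eq_div_iff (by positivity)]
  rw [hprod] at hL'
  linear_combination 6 * hL'

end Squarefree

theorem stmt5 (ε : ℤ) (hε : ε = 1 ∨ ε = -1) (r : ℕ) (hr : 1 ≤ r) :
    Tendsto (fun x : ℝ =>
        (((Finset.Icc 1 ⌊x⌋₊).filter
            (fun m => ArithmeticFunction.moebius m = ε ∧ Nat.Coprime m r)).card : ℝ) /
          (3 * x / (Real.pi ^ 2 * ∏ p ∈ r.primeFactors, (1 + 1 / (p : ℝ)))))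
      atTop (nhds 1) := by
  have : NeZero r := ⟨by omega⟩
  set P := ∏ p ∈ r.primeFactors, (1 + 1 / (p : ℝ)) with hP
  have hP0 : 0 < P := Finset.prod_pos fun p _ ↦ by positivity
  have hcount (N : ℕ) : (((Finset.Icc 1 N).filter
      (fun m ↦ ArithmeticFunction.moebius m = ε ∧ Nat.Coprime m r)).card : ℝ) =
      (squarefreeCoprimeCount r N + ε * ∑ k ∈ Finset.Icc 1 N, (moebiusCoprime r k : ℝ)) / 2 := by
    rw [squarefreeCoprimeCount, Finset.card_filter, Finset.card_filter, Finset.mul_sum]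
    push_cast
    rw [← Finset.sum_add_distrib, Finset.sum_div]
    refine Finset.sum_congr rfl fun m _ ↦ ?_
    have hsq := ArithmeticFunction.moebius_ne_zero_iff_squarefree (n := m)
    by_cases hm : m.Coprime r
    · rcases ArithmeticFunction.moebius_eq_or m with h | h | h <;> rcases hε with rfl | rfl <;>
        simp only [moebiusCoprime, ← hsq, h, eq_true hm] <;> norm_num
    · simp [moebiusCoprime, hm]
  have hQ := (tendsto_squarefreeCoprimeCount_div (r := r) (by omega)).comp
    (tendsto_nat_floor_atTop (α := ℝ))
  rw [totient_div_mul_tsum_moebiusCoprime (by omega), ← hP] at hQ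
  have hQ' := hQ.mul (tendsto_nat_floor_div_atTop (R := ℝ))
  have hlim := ((hQ'.add ((tendsto_sum_moebiusCoprime_div r).const_mul (ε : ℝ))).div_const 2).mul_const
    (Real.pi ^ 2 * P / 3)
  convert! hlim.congr' ?_ using 2
  · field_simp
    norm_num
  · filter_upwards [eventually_ge_atTop 1] with x hx
    have hfl : ((⌊x⌋₊ : ℕ) : ℝ) ≠ 0 := by
      exact_mod_cast (Nat.floor_pos.mpr hx).ne'
    rw [hcount]
    simp only [Function.comp_apply]
    field_simp
end

section
/- For every integer k ≥ 13 one has {−2, −1, 0, 1} ⊆ {a_n(k) : n ≥ 1}; in particular max_{n ≥ 1} |a_n(k)| ≥ 2. -/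
open Polynomial in
theorem cyclotomic_mul_mul_prime_identity {p q r : ℕ} (hp : p.Prime) (hq : q.Prime)
    (hr : r.Prime) (hpq : p < q) (hqr : q < r) :
    cyclotomic (p * q * r) ℤ * (X ^ (p * q) - 1) * (X - 1) * (X ^ (p * r) - 1) *
        (X ^ (q * r) - 1) =
      (X ^ (p * q * r) - 1) * (X ^ p - 1) * (X ^ q - 1) * (X ^ r - 1) := by
  have : Fact p.Prime := ⟨hp⟩
  have h1 : cyclotomic p ℤ * (X - 1) = X ^ p - 1 := cyclotomic_prime_mul_X_sub_one ℤ p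
  have hdq : ¬ q ∣ p := Nat.not_dvd_of_pos_of_lt hp.pos hpq
  have hdr : ¬ r ∣ p * q := by
    rw [hr.dvd_mul, not_or]
    exact ⟨Nat.not_dvd_of_pos_of_lt hp.pos (hpq.trans hqr), Nat.not_dvd_of_pos_of_lt hq.pos hqr⟩
  have h2 := congrArg (expand ℤ q) h1
  simp only [map_mul, map_sub, map_pow, expand_X, map_one,
    cyclotomic_expand_eq_cyclotomic_mul hq hdq] at h2
  have h3 : cyclotomic (p * q) ℤ * (X ^ p - 1) * (X ^ q - 1) = (X ^ (p * q) - 1) * (X - 1) := by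
    rw [← h1, mul_comm p q, pow_mul, ← h2, mul_comm q p]
    ring
  have h4 := congrArg (expand ℤ r) h3
  simp only [map_mul, map_sub, map_pow, expand_X, map_one,
    cyclotomic_expand_eq_cyclotomic_mul hr hdr, ← pow_mul] at h4
  rw [mul_comm r p, mul_comm r q, mul_comm r (p * q)] at h4
  linear_combination (X ^ p - 1) * (X ^ q - 1) * h4 -
    cyclotomic (p * q * r) ℤ * (X ^ (p * r) - 1) * (X ^ (q * r) - 1) * h3

open Polynomial in
/-- The low-order coefficients of a ternary cyclotomic polynomial. -/
theorem coeff_cyclotomic_mul_mul_prime {p q r k : ℕ} (hp : p.Prime) (hq : q.Prime)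
    (hr : r.Prime) (hpq : p < q) (hqr : q < r) (hk : k < p + q) :
    (cyclotomic (p * q * r) ℤ).coeff k =
      1 - (if p ≤ k then 1 else 0) - (if q ≤ k then 1 else 0) - (if r ≤ k then 1 else 0) := by
  have hid := cyclotomic_mul_mul_prime_identity hp hq hr hpq hqr
  set F := cyclotomic (p * q * r) ℤ
  set G : ℤ[X] := ∑ i ∈ Finset.range (k + 1), X ^ i with hG
  have hgeom : G * (X - 1) = X ^ (k + 1) - 1 := geom_sum_mul _ _
  let π := Ideal.Quotient.mk (Ideal.span {(X ^ (k + 1) : ℤ[X])})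
  have hzero : ∀ m, k + 1 ≤ m → π X ^ m = 0 := fun m hm => by
    rw [← map_pow]
    exact Ideal.Quotient.eq_zero_iff_mem.2 (Ideal.mem_span_singleton.2 (pow_dvd_pow X hm))
  have hp2 := hp.two_le
  have hpq' : k + 1 ≤ p * q := by nlinarith
  have hpr' : k + 1 ≤ p * r := by nlinarith
  have hqr' : k + 1 ≤ q * r := by nlinarith
  have hpqr' : k + 1 ≤ p * q * r := hpq'.trans (Nat.le_mul_of_pos_right _ hr.pos)
  have hid' := congrArg π hid
  have hgeom' := congrArg π hgeom
  simp only [map_mul, map_sub, map_pow, map_one, hzero _ hpq', hzero _ hpr', hzero _ hqr',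
    hzero _ hpqr', hzero _ le_rfl] at hid' hgeom'
  have h1 := hzero (p + q) hk
  have h2 := hzero (p + r) (by lia)
  have h3 := hzero (q + r) (by lia)
  rw [pow_add (π X)] at h1 h2 h3
  have key : π F = π (G - X ^ p * G - X ^ q * G - X ^ r * G) := by
    simp only [map_mul, map_sub, map_pow]
    linear_combination π F * hgeom' + π G * hid' + π G * (1 - π X ^ r) * h1 +
      π G * h2 + π G * h3
  rw [Ideal.Quotient.eq, Ideal.mem_span_singleton, X_pow_dvd_iff] at key
  have hcoeff := key k k.lt_succ_self
  have hGc : ∀ m ≤ k, G.coeff m = 1 := fun m hm => by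
    simp [hG, coeff_X_pow, Nat.lt_succ_of_le hm]
  have hGs : ∀ m, (X ^ m * G).coeff k = if m ≤ k then 1 else 0 := fun m => by
    rw [coeff_X_pow_mul']
    split_ifs
    · exact hGc _ (Nat.sub_le _ _)
    · rfl
  rw [coeff_sub, sub_eq_zero] at hcoeff
  rw [hcoeff, coeff_sub, coeff_sub, coeff_sub, hGs, hGs, hGs, hGc k le_rfl]

theorem succ_pow_eight_le_two_pow {m : ℕ} (hm : 44 ≤ m) : (m + 1) ^ 8 ≤ 2 ^ m := by
  induction m, hm using Nat.le_induction with
  | base => norm_num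
  | succ m hm ih =>
    have h : (45 * (m + 2)) ^ 8 ≤ (46 * (m + 1)) ^ 8 := Nat.pow_le_pow_left (by lia) 8
    rw [mul_pow, mul_pow] at h
    rw [pow_succ 2 m, show m + 1 + 1 = m + 2 from rfl]
    norm_num at h
    lia

theorem mul_pow_sqrt_add_two_mul_four_pow_le {n : ℕ} (hn : 1024 ≤ n) :
    n * ((2 * n) ^ Nat.sqrt (2 * n) * 4 ^ (2 * n / 3) * (2 * n) ^ 2) ≤ 4 ^ n := by
  set m := Nat.sqrt (2 * n) with hm
  have hm44 : 44 ≤ m := Nat.le_sqrt.2 (by lia)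
  have hmn : m * m ≤ 2 * n := Nat.sqrt_le _
  have hnm : 2 * n ≤ (m + 1) ^ 2 := by
    rw [sq]
    exact (Nat.lt_succ_sqrt (2 * n)).le
  have hcube : ((2 * n) ^ (m + 3)) ^ 3 ≤ (4 ^ (n - 2 * n / 3)) ^ 3 := calc
    ((2 * n) ^ (m + 3)) ^ 3 ≤ (((m + 1) ^ 2) ^ (m + 3)) ^ 3 := by gcongr
    _ = (m + 1) ^ (6 * (m + 3)) := by
      rw [← pow_mul, ← pow_mul]
      congr 1
      ring
    _ ≤ (m + 1) ^ (8 * m) := Nat.pow_le_pow_right (by lia) (by lia)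
    _ = ((m + 1) ^ 8) ^ m := pow_mul _ _ _
    _ ≤ (2 ^ m) ^ m := Nat.pow_le_pow_left (succ_pow_eight_le_two_pow hm44) m
    _ = 2 ^ (m * m) := (pow_mul _ _ _).symm
    _ ≤ 2 ^ (2 * (n - 2 * n / 3) * 3) := Nat.pow_le_pow_right two_pos (by lia)
    _ = (4 ^ (n - 2 * n / 3)) ^ 3 := by rw [pow_mul, pow_mul]; norm_num
  have h := (Nat.pow_le_pow_iff_left three_ne_zero).1 hcube
  calc n * ((2 * n) ^ m * 4 ^ (2 * n / 3) * (2 * n) ^ 2)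
      ≤ (2 * n) * ((2 * n) ^ m * 4 ^ (2 * n / 3) * (2 * n) ^ 2) := by gcongr; lia
    _ = (2 * n) ^ (m + 3) * 4 ^ (2 * n / 3) := by ring
    _ ≤ 4 ^ (n - 2 * n / 3) * 4 ^ (2 * n / 3) := by gcongr
    _ = 4 ^ n := by rw [← pow_add]; congr 1; lia

/-- A bound on the central binomial coefficient in terms of the number of primes in `(n, 2n]`. -/
theorem centralBinom_le_of_card_primes (n : ℕ) (hn : 2 < n) :
    n.centralBinom ≤ (2 * n) ^ Nat.sqrt (2 * n) * 4 ^ (2 * n / 3) *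
      (2 * n) ^ ((Finset.Ioc n (2 * n)).filter Nat.Prime).card := by
  have n2_pos : 0 < 2 * n := by lia
  let f x := x ^ n.centralBinom.factorization x
  have hf : ∀ p, f p ≤ 2 * n := fun p => Nat.pow_factorization_choose_le n2_pos
  let A := {p ∈ Finset.range (2 * n / 3 + 1) | p.Prime ∧ p ≤ Nat.sqrt (2 * n)}
  let B := {p ∈ Finset.range (2 * n / 3 + 1) | p.Prime ∧ Nat.sqrt (2 * n) < p}
  let T := (Finset.Ioc n (2 * n)).filter Nat.Prime
  have hAB : Disjoint A B := Finset.disjoint_left.2 fun p hA hB => by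
    simp only [A, B, Finset.mem_filter] at hA hB
    lia
  have hT : Disjoint (A ∪ B) T := Finset.disjoint_left.2 fun p hA hB => by
    simp only [A, B, T, Finset.mem_filter, Finset.mem_union, Finset.mem_range,
      Finset.mem_Ioc] at hA hB
    lia
  have hprod : n.centralBinom = (∏ p ∈ A, f p) * (∏ p ∈ B, f p) * ∏ p ∈ T, f p := by
    rw [← Finset.prod_union hAB, ← Finset.prod_union hT]
    refine (Eq.trans ?_ n.prod_pow_factorization_centralBinom).symm
    refine Finset.prod_subset (fun p hp => ?_) fun p hp hp' => ?_
    · simp only [A, B, T, Finset.mem_filter, Finset.mem_union, Finset.mem_range,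
        Finset.mem_Ioc] at hp ⊢
      lia
    · by_cases hpr : p.Prime
      · simp only [A, B, T, Finset.mem_filter, Finset.mem_union, Finset.mem_range,
          Finset.mem_Ioc, hpr, true_and, and_true] at hp hp'
        have h0 := Nat.factorization_centralBinom_of_two_mul_self_lt_three_mul
          (p := p) hn (by lia) (by lia)
        simp only [f, h0, pow_zero]
      · simp only [f, Nat.factorization_eq_zero_of_not_prime _ hpr, pow_zero]
  rw [hprod]
  refine Nat.mul_le_mul (Nat.mul_le_mul ?_ ?_) ?_
  · refine (Finset.prod_le_pow_card A f _ fun p _ => hf p).trans (Nat.pow_le_pow_right n2_pos ?_)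
    have hsub : A ⊆ Finset.Icc 1 (Nat.sqrt (2 * n)) := fun p hp => by
      obtain ⟨-, hpr, hle⟩ := Finset.mem_filter.1 hp
      exact Finset.mem_Icc.2 ⟨hpr.one_le, hle⟩
    simpa using Finset.card_le_card hsub
  · refine le_trans ?_ (primorial_le_four_pow (2 * n / 3))
    calc ∏ p ∈ B, f p ≤ ∏ p ∈ B, p := Finset.prod_le_prod' fun p hp => by
          obtain ⟨-, hpr, hlt⟩ := Finset.mem_filter.1 hp
          exact (Nat.pow_le_pow_right hpr.pos
            (Nat.factorization_choose_le_one (Nat.sqrt_lt'.1 hlt))).trans (pow_one p).le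
      _ ≤ primorial (2 * n / 3) := by
          refine Finset.prod_le_prod_of_subset_of_one_le' (fun p hp => ?_) fun p hp _ => ?_
          · obtain ⟨hr, hpr, -⟩ := Finset.mem_filter.1 hp
            exact Finset.mem_filter.2 ⟨hr, hpr⟩
          · exact (Finset.mem_filter.1 hp).2.one_le
  · exact Finset.prod_le_pow_card T f _ fun p _ => hf p

theorem two_lt_card_primes_Ioc {n : ℕ} (hn : 1024 ≤ n) :
    2 < ((Finset.Ioc n (2 * n)).filter Nat.Prime).card := by
  by_contra! hcard
  have h1 := Nat.four_pow_lt_mul_centralBinom n (by lia)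
  have h2 := centralBinom_le_of_card_primes n (by lia)
  have h3 : (2 * n) ^ ((Finset.Ioc n (2 * n)).filter Nat.Prime).card ≤ (2 * n) ^ 2 :=
    Nat.pow_le_pow_right (by lia) hcard
  grw [h3] at h2
  grw [h2, mul_pow_sqrt_add_two_mul_four_pow_le hn] at h1
  exact lt_irrefl _ h1

theorem exists_three_primes_le_of_large {k : ℕ} (hk : 2048 ≤ k) :
    ∃ p q r : ℕ, p.Prime ∧ q.Prime ∧ r.Prime ∧ p < q ∧ q < r ∧ r ≤ k ∧ k < p + q := by
  obtain ⟨a, b, c, ha, hb, hc, hab, hac, hbc⟩ :=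
    Finset.two_lt_card_iff.1 (two_lt_card_primes_Ioc (n := k / 2) (by lia))
  simp only [Finset.mem_filter, Finset.mem_Ioc] at ha hb hc
  rcases lt_or_gt_of_ne hab with h1 | h1 <;> rcases lt_or_gt_of_ne hac with h2 | h2 <;>
    rcases lt_or_gt_of_ne hbc with h3 | h3
  · exact ⟨a, b, c, ha.2, hb.2, hc.2, h1, h3, by lia, by lia⟩
  · exact ⟨a, c, b, ha.2, hc.2, hb.2, h2, h3, by lia, by lia⟩
  · lia
  · exact ⟨c, a, b, hc.2, ha.2, hb.2, h2, h1, by lia, by lia⟩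
  · exact ⟨b, a, c, hb.2, ha.2, hc.2, h1, h2, by lia, by lia⟩
  · lia
  · exact ⟨b, c, a, hb.2, hc.2, ha.2, h3, h2, by lia, by lia⟩
  · exact ⟨c, b, a, hc.2, hb.2, ha.2, h3, h1, by lia, by lia⟩

theorem exists_three_primes_le {k : ℕ} (hk : 13 ≤ k) :
    ∃ p q r : ℕ, p.Prime ∧ q.Prime ∧ r.Prime ∧ p < q ∧ q < r ∧ r ≤ k ∧ k < p + q := by
  rcases lt_or_ge k 18 with h | h
  · exact ⟨7, 11, 13, by norm_num, by norm_num, by norm_num, by lia, by lia, by lia, by lia⟩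
  rcases lt_or_ge k 24 with h | h
  · exact ⟨11, 13, 17, by norm_num, by norm_num, by norm_num, by lia, by lia, by lia, by lia⟩
  rcases lt_or_ge k 36 with h | h
  · exact ⟨17, 19, 23, by norm_num, by norm_num, by norm_num, by lia, by lia, by lia, by lia⟩
  rcases lt_or_ge k 52 with h | h
  · exact ⟨23, 29, 31, by norm_num, by norm_num, by norm_num, by lia, by lia, by lia, by lia⟩
  rcases lt_or_ge k 84 with h | h
  · exact ⟨41, 43, 47, by norm_num, by norm_num, by norm_num, by lia, by lia, by lia, by lia⟩
  rcases lt_or_ge k 152 with h | h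
  · exact ⟨73, 79, 83, by norm_num, by norm_num, by norm_num, by lia, by lia, by lia, by lia⟩
  rcases lt_or_ge k 288 with h | h
  · exact ⟨139, 149, 151, by norm_num, by norm_num, by norm_num, by lia, by lia, by lia, by lia⟩
  rcases lt_or_ge k 558 with h | h
  · exact ⟨277, 281, 283, by norm_num, by norm_num, by norm_num, by lia, by lia, by lia, by lia⟩
  rcases lt_or_ge k 1088 with h | h
  · exact ⟨541, 547, 557, by norm_num, by norm_num, by norm_num, by lia, by lia, by lia, by lia⟩
  rcases lt_or_ge k 2132 with h | h
  · exact ⟨1063, 1069, 1087, by norm_num, by norm_num, by norm_num, by lia, by lia, by lia, by lia⟩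
  exact exists_three_primes_le_of_large (by lia)

theorem stmt11 (k : ℕ) (hk : 13 ≤ k) :
    (∀ v : ℤ, v = -2 ∨ v = -1 ∨ v = 0 ∨ v = 1 →
      ∃ n : ℕ, 1 ≤ n ∧ (Polynomial.cyclotomic n ℤ).coeff k = v) ∧
    (∃ n : ℕ, 1 ≤ n ∧ 2 ≤ |(Polynomial.cyclotomic n ℤ).coeff k|) := by
  obtain ⟨p, q, r, hp, hq, hr, hpq, hqr, hrk, hkpq⟩ := exists_three_primes_le hk
  obtain ⟨s, hks, hs⟩ := Nat.exists_infinite_primes (k + 1)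
  obtain ⟨t, hst, ht⟩ := Nat.exists_infinite_primes (s + 1)
  obtain ⟨u, htu, hu⟩ := Nat.exists_infinite_primes (t + 1)
  have hneg_two : (Polynomial.cyclotomic (p * q * r) ℤ).coeff k = -2 := by
    rw [coeff_cyclotomic_mul_mul_prime hp hq hr hpq hqr hkpq, if_pos (by lia), if_pos (by lia),
      if_pos hrk]
    norm_num
  have hpos : 1 ≤ p * q * r := Nat.mul_pos (Nat.mul_pos hp.pos hq.pos) hr.pos
  refine ⟨?_, p * q * r, hpos, by rw [hneg_two]; norm_num⟩
  rintro v (rfl | rfl | rfl | rfl)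
  · exact ⟨_, hpos, hneg_two⟩
  · refine ⟨p * q * s, Nat.mul_pos (Nat.mul_pos hp.pos hq.pos) hs.pos, ?_⟩
    rw [coeff_cyclotomic_mul_mul_prime hp hq hs hpq (by lia) hkpq, if_pos (by lia),
      if_pos (by lia), if_neg (by lia)]
    norm_num
  · refine ⟨p * s * t, Nat.mul_pos (Nat.mul_pos hp.pos hs.pos) ht.pos, ?_⟩
    rw [coeff_cyclotomic_mul_mul_prime hp hs ht (by lia) (by lia) (by lia), if_pos (by lia),
      if_neg (by lia), if_neg (by lia)]
    norm_num
  · refine ⟨s * t * u, Nat.mul_pos (Nat.mul_pos hs.pos ht.pos) hu.pos, ?_⟩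
    rw [coeff_cyclotomic_mul_mul_prime hs ht hu (by lia) (by lia) (by lia), if_neg (by lia),
      if_neg (by lia), if_neg (by lia)]
    norm_num
end
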